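/- Let f, g₁, …, g_p be real polynomials in m variables, let γ ∈ ℕ satisfy deg f ≤ 2γ and deg g_i ≤ 2β_i with β_i ≤ γ for each i, and let x ∈ ℝ^m satisfy g_i(x) ≥ 0 for all i. Define the moment sequence y : (Fin m →₀ ℕ) → ℝ by y_α = x^α. Then y is feasible for the order-γ moment relaxation: y_0 = 1, the moment matrix M_γ(y) is positive semidefinite, each localizing matrix M_{γ−β_i}(g_i y) is positive semidefinite; moreover the relaxation objective satisfies L_y(f) = f(x). Consequently the optimal value of the order-γ moment relaxation is a lower bound on the optimal value of the polynomial optimization problem min f(x) subject to g_i(x) ≥ 0. -/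

import Mathlib

open MvPolynomial

noncomputable section

/-- Total degree of an exponent vector `α ∈ (Fin m →₀ ℕ)`. -/
def degSum {m : ℕ} (α : Fin m →₀ ℕ) : ℕ := ∑ i, α i

/-- Index set of the order-`γ` moment matrix: exponent vectors of total degree at most `γ`. -/
def MomIdx (m γ : ℕ) : Type := {α : Fin m →₀ ℕ // degSum α ≤ γ}

instance momIdxFinite (m γ : ℕ) : Finite (MomIdx m γ) := by
  have h : ∀ (a : MomIdx m γ) (i : Fin m), a.1 i < γ + 1 := fun a i =>
    Nat.lt_succ_of_le (le_trans
      (Finset.single_le_sum (fun j _ => Nat.zero_le (a.1 j)) (Finset.mem_univ i)) a.2)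
  exact Finite.of_injective
    (fun a : MomIdx m γ => (fun i => (⟨a.1 i, h a i⟩ : Fin (γ + 1))))
    (fun a b hab => Subtype.ext (Finsupp.ext fun i =>
      congrArg Fin.val (congrFun hab i)))

instance momIdxFintype (m γ : ℕ) : Fintype (MomIdx m γ) := Fintype.ofFinite _

/-- The monomial `x^α = ∏ i, x i ^ α i`. -/
def monoEval {m : ℕ} (x : Fin m → ℝ) (α : Fin m →₀ ℕ) : ℝ := ∏ i, x i ^ α i

/-- The order-`γ` moment matrix of a moment sequence `y`. -/
def momMat {m : ℕ} (γ : ℕ) (y : (Fin m →₀ ℕ) → ℝ) :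
    Matrix (MomIdx m γ) (MomIdx m γ) ℝ :=
  Matrix.of fun a b => y (a.1 + b.1)

/-- The localizing matrix of a polynomial `g` with respect to a moment sequence `y`,
indexed by exponent vectors of total degree at most `η`. -/
def locMat {m : ℕ} (η : ℕ) (g : MvPolynomial (Fin m) ℝ) (y : (Fin m →₀ ℕ) → ℝ) :
    Matrix (MomIdx m η) (MomIdx m η) ℝ :=
  Matrix.of fun a b => ∑ δ ∈ g.support, g.coeff δ * y (a.1 + b.1 + δ)

/-- The linear functional `L_y` replacing each monomial of a polynomial by its moment. -/
def Lf {m : ℕ} (y : (Fin m →₀ ℕ) → ℝ) (f : MvPolynomial (Fin m) ℝ) : ℝ :=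
  ∑ α ∈ f.support, f.coeff α * y α

theorem monoEval_zero {m : ℕ} (x : Fin m → ℝ) : monoEval x 0 = 1 := by
  simp [monoEval]

theorem monoEval_add {m : ℕ} (x : Fin m → ℝ) (α β : Fin m →₀ ℕ) :
    monoEval x (α + β) = monoEval x α * monoEval x β := by
  simp [monoEval, pow_add, Finset.prod_mul_distrib]

theorem Lf_monoEval {m : ℕ} (x : Fin m → ℝ) (f : MvPolynomial (Fin m) ℝ) :
    Lf (fun α => monoEval x α) f = MvPolynomial.eval x f :=
  (MvPolynomial.eval_eq' x f).symm

theorem posSemidef_momMat_monoEval {m : ℕ} (γ : ℕ) (x : Fin m → ℝ) :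
    (momMat γ (fun α => monoEval x α)).PosSemidef := by
  convert Matrix.posSemidef_vecMulVec_self_star (fun a : MomIdx m γ => monoEval x a.1) using 1
  ext a b
  simp [momMat, Matrix.vecMulVec_apply, monoEval_add]

theorem locMat_monoEval {m : ℕ} (η : ℕ) (g : MvPolynomial (Fin m) ℝ) (x : Fin m → ℝ) :
    locMat η g (fun α => monoEval x α) =
      MvPolynomial.eval x g • momMat η (fun α => monoEval x α) := by
  ext a b
  simp only [locMat, momMat, Matrix.of_apply, Matrix.smul_apply, smul_eq_mul, ← Lf_monoEval, Lf,
    Finset.sum_mul, monoEval_add]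
  exact Finset.sum_congr rfl fun δ _ => by ring

theorem posSemidef_locMat_monoEval {m : ℕ} (η : ℕ) (g : MvPolynomial (Fin m) ℝ)
    (x : Fin m → ℝ) (hx : 0 ≤ MvPolynomial.eval x g) :
    (locMat η g (fun α => monoEval x α)).PosSemidef := by
  rw [locMat_monoEval]
  exact (posSemidef_momMat_monoEval η x).smul hx

/-- the moment sequence `y_α = x^α` of a feasible point `x` is feasible for
the order-`γ` moment relaxation, with relaxation objective `L_y f = f(x)`; consequently
the optimal value of the relaxation is a lower bound on the optimal value of the
polynomial optimization problem. -/
theorem point_evaluation_feasible_for_moment_relaxation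
    (m p γ : ℕ) (f : MvPolynomial (Fin m) ℝ) (g : Fin p → MvPolynomial (Fin m) ℝ)
    (β : Fin p → ℕ) (hf : f.totalDegree ≤ 2 * γ)
    (hg : ∀ i, (g i).totalDegree ≤ 2 * β i) (hβ : ∀ i, β i ≤ γ)
    (x : Fin m → ℝ) (hx : ∀ i, 0 ≤ MvPolynomial.eval x (g i)) :
    monoEval x 0 = 1 ∧
    (momMat γ (fun α => monoEval x α) : Matrix (MomIdx m γ) (MomIdx m γ) ℝ).PosSemidef ∧
    (∀ i, (locMat (γ - β i) (g i) (fun α => monoEval x α) :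
        Matrix (MomIdx m (γ - β i)) (MomIdx m (γ - β i)) ℝ).PosSemidef) ∧
    Lf (fun α => monoEval x α) f = MvPolynomial.eval x f ∧
    (∀ v : ℝ,
      (∀ y : (Fin m →₀ ℕ) → ℝ, y 0 = 1 →
        (momMat γ y : Matrix (MomIdx m γ) (MomIdx m γ) ℝ).PosSemidef →
        (∀ i, (locMat (γ - β i) (g i) y :
            Matrix (MomIdx m (γ - β i)) (MomIdx m (γ - β i)) ℝ).PosSemidef) →
        v ≤ Lf y f) →
      v ≤ MvPolynomial.eval x f) := by
  have h_loc := fun i => posSemidef_locMat_monoEval (γ - β i) (g i) x (hx i)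
  refine ⟨monoEval_zero x, posSemidef_momMat_monoEval γ x, h_loc, Lf_monoEval x f,
    fun v hv => ?_⟩
  rw [← Lf_monoEval x f]
  exact hv _ (monoEval_zero x) (posSemidef_momMat_monoEval γ x) h_loc
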